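/- arXiv:0906.3596 — 12 statements merged into one kernel-verified Lean document; each statement's English description precedes it below -/
import Mathlib

section
/- Let H be a real Hilbert space, A and S bounded linear operators on H with A skew-symmetric and S symmetric and nonpositive, L = A + S, and λ > 0. Then for every f ∈ H the resolvent quadratic form admits the variational characterization ⟨f, (λ − L)⁻¹ f⟩ = sup over u ∈ H of ( 2⟨f, u⟩ − ⟨u, (λ − S) u⟩ − ⟨A u, (λ − S)⁻¹ (A u)⟩ ). -/
open scoped RealInnerProductSpace

/-- A bounded operator on a real Hilbert space with coercive quadratic form is surjective. -/
lemma ContinuousLinearMap.surjective_of_le_inner_self {H : Type*} [NormedAddCommGroup H]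
    [InnerProductSpace ℝ H] [CompleteSpace H] (T : H →L[ℝ] H) {c : ℝ} (hc : 0 < c)
    (hT : ∀ u : H, c * ⟪u, u⟫ ≤ ⟪T u, u⟫) : Function.Surjective T := by
  have hB : IsCoercive ((innerSL ℝ).comp T) := by
    refine ⟨c, hc, fun u => ?_⟩
    simpa [mul_assoc, ← pow_two] using hT u
  intro y
  obtain ⟨x, hx⟩ := hB.continuousLinearEquivOfBilin.surjective y
  refine ⟨x, ext_inner_right ℝ fun v => ?_⟩
  simpa [hx] using (hB.continuousLinearEquivOfBilin_apply x v).symm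

/-- Let `H` be a real Hilbert space, `A` and `S` bounded linear operators on
`H` with `A` skew-symmetric and `S` symmetric and nonpositive, `L = A + S`, and `λ > 0`.
Then for every `f ∈ H` the resolvent quadratic form admits the variational characterization
`⟨f, (λ − L)⁻¹ f⟩ = sup_{u ∈ H} ( 2⟨f, u⟩ − ⟨u, (λ − S) u⟩ − ⟨A u, (λ − S)⁻¹ (A u)⟩ )`.
Here `g = (λ − L)⁻¹ f` and `w u = (λ − S)⁻¹ (A u)` are characterized by the resolvent
equations given as hypotheses, and the supremum is expressed as a least upper bound. -/
theorem stmt1 {H : Type*} [NormedAddCommGroup H] [InnerProductSpace ℝ H] [CompleteSpace H]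
    (A S L : H →L[ℝ] H)
    (hA : ∀ u v : H, ⟪A u, v⟫ = -⟪u, A v⟫)
    (hSsymm : ∀ u v : H, ⟪S u, v⟫ = ⟪u, S v⟫)
    (hSneg : ∀ u : H, ⟪u, S u⟫ ≤ 0)
    (hL : L = A + S)
    (lam : ℝ) (hlam : 0 < lam)
    (f g : H) (hg : (lam • ContinuousLinearMap.id ℝ H - L) g = f)
    (w : H → H) (hw : ∀ u : H, (lam • ContinuousLinearMap.id ℝ H - S) (w u) = A u) :
    IsLUB {r : ℝ | ∃ u : H,
        r = 2 * ⟪f, u⟫ - ⟪u, (lam • ContinuousLinearMap.id ℝ H - S) u⟫ - ⟪A u, w u⟫}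
      ⟪f, g⟫ := by
  set K := lam • ContinuousLinearMap.id ℝ H - S with hK
  have hKapply : ∀ u, K u = lam • u - S u := fun u => by simp [hK]
  have hKsymm : ∀ u v : H, ⟪K u, v⟫ = ⟪u, K v⟫ := fun u v => by
    simp only [hKapply, inner_sub_left, inner_sub_right, inner_smul_left, inner_smul_right,
      hSsymm, conj_trivial]
  have hKcoer : ∀ u : H, lam * ⟪u, u⟫ ≤ ⟪K u, u⟫ := fun u => by
    rw [hKsymm, hKapply, inner_sub_right, inner_smul_right]
    linarith [hSneg u]
  have hKnonneg : ∀ u : H, 0 ≤ ⟪K u, u⟫ := fun u =>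
    (mul_nonneg hlam.le real_inner_self_nonneg).trans (hKcoer u)
  have hAself : ∀ u : H, ⟪A u, u⟫ = 0 := fun u => by
    have := hA u u
    rw [real_inner_comm (A u) u] at this
    linarith
  have hf : f = K g - A g := by
    rw [← hg, hL, hKapply]
    simp only [sub_apply, add_apply,
      smul_apply, ContinuousLinearMap.id_apply]
    abel
  have key : ∀ u : H, 2 * ⟪f, u⟫ - ⟪u, K u⟫ - ⟪A u, w u⟫
      = ⟪f, g⟫ - ⟪K (g - (u + w u)), g - (u + w u)⟫ := fun u => by
    have h₁ := hAself g
    have h₂ := hAself u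
    have h₃ := hA g u
    have h₄ := hKsymm g u
    have h₅ := hKsymm g (w u)
    have h₆ := hKsymm u (w u)
    rw [hw u] at h₅ h₆
    rw [real_inner_comm (A u) u] at h₆
    simp only [hf, map_sub, map_add, hw u, inner_sub_left, inner_sub_right, inner_add_left,
      inner_add_right]
    linarith [real_inner_comm (K u) g, real_inner_comm (K u) u, real_inner_comm (A u) g]
  constructor
  · rintro r ⟨u, rfl⟩
    rw [key u]
    linarith [hKnonneg (g - (u + w u))]
  · intro b hb
    obtain ⟨u, hu⟩ := (K + A).surjective_of_le_inner_self hlam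
      (fun u => by simpa [inner_add_left, hAself u] using hKcoer u) (K g)
    refine hb ⟨u, ?_⟩
    have hzero : K (g - (u + w u)) = 0 := by
      rw [map_sub, map_add, hw u, ← hu, add_apply, sub_self]
    rw [key u, hzero, inner_zero_left, sub_zero]
end

section
/- Let H be a real Hilbert space, A and S bounded linear operators on H with A skew-symmetric and S symmetric and nonpositive, L = A + S, and λ > 0. Then for every f ∈ H one has the upper bound ⟨f, (λ − L)⁻¹ f⟩ ≤ ⟨f, (λ − S)⁻¹ f⟩. -/
open scoped RealInnerProductSpace

/-- Let `H` be a real Hilbert space, `A` and `S` bounded linear operators on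
`H` with `A` skew-symmetric and `S` symmetric and nonpositive, `L = A + S`, and `λ > 0`.
Then for every `f ∈ H` one has the upper bound `⟨f, (λ − L)⁻¹ f⟩ ≤ ⟨f, (λ − S)⁻¹ f⟩`.
Here `g = (λ − L)⁻¹ f` and `h = (λ − S)⁻¹ f` are characterized by the resolvent equations
given as hypotheses. -/
theorem stmt2 {H : Type*} [NormedAddCommGroup H] [InnerProductSpace ℝ H] [CompleteSpace H]
    (A S L : H →L[ℝ] H)
    (hA : ∀ u v : H, ⟪A u, v⟫ = -⟪u, A v⟫)
    (hSsymm : ∀ u v : H, ⟪S u, v⟫ = ⟪u, S v⟫)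
    (hSneg : ∀ u : H, ⟪u, S u⟫ ≤ 0)
    (hL : L = A + S)
    (lam : ℝ) (hlam : 0 < lam)
    (f g h : H)
    (hg : (lam • ContinuousLinearMap.id ℝ H - L) g = f)
    (hh : (lam • ContinuousLinearMap.id ℝ H - S) h = f) :
    ⟪f, g⟫ ≤ ⟪f, h⟫ := by
  subst hL
  simp only [sub_apply, add_apply, smul_apply,
    ContinuousLinearMap.id_apply] at hg hh
  have hAg : ⟪A g, g⟫ = 0 := by
    have := hA g g
    rw [real_inner_comm (A g) g] at this
    linarith
  have hfg : ⟪f, g⟫ = lam * ⟪g, g⟫ - ⟪S g, g⟫ := by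
    rw [← hg]
    simp only [inner_sub_left, inner_add_left, real_inner_smul_left, hAg, zero_add]
  have hfg' : ⟪f, g⟫ = lam * ⟪h, g⟫ - ⟪S h, g⟫ := by
    rw [← hh, inner_sub_left, real_inner_smul_left]
  have hfh : ⟪f, h⟫ = lam * ⟪h, h⟫ - ⟪S h, h⟫ := by
    rw [← hh, inner_sub_left, real_inner_smul_left]
  have hcross : ⟪S g, h⟫ = ⟪S h, g⟫ := by
    rw [hSsymm, real_inner_comm]
  have hS := hSneg (h - g)
  have hnorm : 0 ≤ lam * ⟪h - g, h - g⟫ := mul_nonneg hlam.le real_inner_self_nonneg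
  rw [← hSsymm] at hS
  simp only [map_sub, inner_sub_left, inner_sub_right, real_inner_comm h g] at hS hnorm
  linarith [real_inner_comm h g]
end

section
/- Let H be a real Hilbert space, A and S bounded linear operators on H with A skew-symmetric and S symmetric and nonpositive, L = A + S, and λ > 0. Then for every f ∈ H and every test vector u ∈ H one has the lower bound ⟨f, (λ − L)⁻¹ f⟩ ≥ 2⟨f, u⟩ − ⟨u, (λ − S) u⟩ − ⟨A u, (λ − S)⁻¹ (A u)⟩. -/
open scoped RealInnerProductSpace

/-- Let `H` be a real Hilbert space, `A` and `S` bounded linear operators on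
`H` with `A` skew-symmetric and `S` symmetric and nonpositive, `L = A + S`, and `λ > 0`.
Then for every `f ∈ H` and every test vector `u ∈ H` one has the lower bound
`⟨f, (λ − L)⁻¹ f⟩ ≥ 2⟨f, u⟩ − ⟨u, (λ − S) u⟩ − ⟨A u, (λ − S)⁻¹ (A u)⟩`.
Here `g = (λ − L)⁻¹ f` and `w = (λ − S)⁻¹ (A u)` are characterized by the resolvent
equations given as hypotheses. -/
theorem stmt3 {H : Type*} [NormedAddCommGroup H] [InnerProductSpace ℝ H] [CompleteSpace H]
    (A S L : H →L[ℝ] H)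
    (hA : ∀ u v : H, ⟪A u, v⟫ = -⟪u, A v⟫)
    (hSsymm : ∀ u v : H, ⟪S u, v⟫ = ⟪u, S v⟫)
    (hSneg : ∀ u : H, ⟪u, S u⟫ ≤ 0)
    (hL : L = A + S)
    (lam : ℝ) (hlam : 0 < lam)
    (f g u w : H)
    (hg : (lam • ContinuousLinearMap.id ℝ H - L) g = f)
    (hw : (lam • ContinuousLinearMap.id ℝ H - S) w = A u) :
    2 * ⟪f, u⟫ - ⟪u, (lam • ContinuousLinearMap.id ℝ H - S) u⟫ - ⟪A u, w⟫ ≤ ⟪f, g⟫ := by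
  set B : H →L[ℝ] H := lam • ContinuousLinearMap.id ℝ H - S with hB
  have hBsymm : ∀ x y : H, ⟪B x, y⟫ = ⟪x, B y⟫ := fun x y => by
    simp [hB, inner_sub_left, inner_sub_right, inner_smul_left, inner_smul_right, hSsymm]
  have hBnonneg : ∀ x : H, 0 ≤ ⟪x, B x⟫ := fun x => by
    have hx : ⟪x, B x⟫ = lam * ⟪x, x⟫ - ⟪x, S x⟫ := by
      simp [hB, inner_sub_right, inner_smul_right]
    rw [hx]
    linarith [mul_nonneg hlam.le (real_inner_self_nonneg (x := x)), hSneg x]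
  have hf : f = B g - A g := by
    rw [← hg, hL]
    simp only [hB, sub_apply, add_apply]
    abel
  have hAself : ∀ x : H, ⟪x, A x⟫ = 0 := fun x => by
    linarith [hA x x, real_inner_comm x (A x)]
  have huw : ⟪u, B w⟫ = 0 := by rw [hw, hAself]
  have hgw : ⟪A g, u⟫ = -⟪g, B w⟫ := by rw [hA, hw]
  have hwu : ⟪w, B u⟫ = ⟪u, B w⟫ := by rw [← hBsymm, real_inner_comm]
  have hug : ⟪u, B g⟫ = ⟪g, B u⟫ := by rw [← hBsymm, real_inner_comm]
  have hwg : ⟪w, B g⟫ = ⟪g, B w⟫ := by rw [← hBsymm, real_inner_comm]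
  have hAg : ⟪A g, g⟫ = 0 := by rw [real_inner_comm, hAself]
  have hsq := hBnonneg (g - u - w)
  simp only [map_sub, inner_sub_left, inner_sub_right] at hsq
  rw [hf, ← hw, inner_sub_left, inner_sub_left, hBsymm g u, hBsymm g g, hBsymm w w]
  linarith
end

section
/- Let H be a real Hilbert space, A and S bounded linear operators on H with A skew-symmetric and S symmetric and nonpositive, L = A + S, and λ > 0. Suppose f ∈ H is an eigenvector of S with S f = −γ f for some γ > 0. Then ⟨f, (λ − L)⁻¹ f⟩ ≤ ‖f‖² / (λ + γ). -/
open scoped RealInnerProductSpace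

/-- Let `H` be a real Hilbert space, `A` and `S` bounded linear operators on
`H` with `A` skew-symmetric and `S` symmetric and nonpositive, `L = A + S`, and `λ > 0`.
Suppose `f ∈ H` is an eigenvector of `S` with `S f = −γ f` for some `γ > 0`.
Then `⟨f, (λ − L)⁻¹ f⟩ ≤ ‖f‖² / (λ + γ)`.
Here `g = (λ − L)⁻¹ f` is characterized by the resolvent equation given as a hypothesis. -/
theorem stmt4 {H : Type*} [NormedAddCommGroup H] [InnerProductSpace ℝ H] [CompleteSpace H]
    (A S L : H →L[ℝ] H)
    (hA : ∀ u v : H, ⟪A u, v⟫ = -⟪u, A v⟫)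
    (hSsymm : ∀ u v : H, ⟪S u, v⟫ = ⟪u, S v⟫)
    (hSneg : ∀ u : H, ⟪u, S u⟫ ≤ 0)
    (hL : L = A + S)
    (lam : ℝ) (hlam : 0 < lam)
    (gam : ℝ) (hgam : 0 < gam)
    (f g : H)
    (hf : S f = -gam • f)
    (hg : (lam • ContinuousLinearMap.id ℝ H - L) g = f) :
    ⟪f, g⟫ ≤ ‖f‖ ^ 2 / (lam + gam) := by
  subst hL
  have hskew : ⟪g, A g⟫ = 0 := by
    have h := hA g g
    rw [real_inner_comm] at h
    linarith
  have henergy : ⟪f, g⟫ = lam * ⟪g, g⟫ - ⟪g, S g⟫ := by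
    have h := congrArg (fun x => ⟪g, x⟫) hg
    simp only [sub_apply, add_apply, smul_apply,
      ContinuousLinearMap.id_apply, inner_sub_right, inner_add_right, real_inner_smul_right,
      hskew] at h
    rw [real_inner_comm]
    linarith
  have hfSg : ⟪f, S g⟫ = -gam * ⟪f, g⟫ := by
    rw [← hSsymm, hf, real_inner_smul_left]
  -- Positivity of the quadratic form of `lam - S` at `(lam + gam) • g - f`.
  have hS := hSneg ((lam + gam) • g - f)
  have hnorm : 0 ≤ lam * ⟪(lam + gam) • g - f, (lam + gam) • g - f⟫ :=
    mul_nonneg hlam.le real_inner_self_nonneg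
  have hgf : ⟪g, f⟫ = ⟪f, g⟫ := real_inner_comm f g
  simp only [map_sub, map_smul, hf, inner_sub_left, inner_sub_right, real_inner_smul_left,
    real_inner_smul_right, hfSg, hgf] at hS hnorm
  have hc : 0 < lam + gam := by positivity
  rw [le_div_iff₀ hc, ← real_inner_self_eq_norm_sq]
  refine le_of_mul_le_mul_left ?_ hc
  linear_combination hnorm + hS - (lam + gam) ^ 2 * henergy
end

section
/- Fix an integer N ≥ 3 and reals α > 0, ν ≥ 0. Let q, p : ℝ → ℝ^{ℤ/Nℤ} be differentiable functions of time satisfying, for every t and every x ∈ ℤ/Nℤ, the harmonic Hamiltonian equations q̇_x(t) = p_x(t) and ṗ_x(t) = 2α (q_{x+1}(t) − 2 q_x(t) + q_{x−1}(t)) − 2ν q_x(t). Then the total energy current 𝔍(t) = −α Σ_{x ∈ ℤ/Nℤ} (q_{x+1}(t) − q_x(t)) (p_x(t) + p_{x+1}(t)) is constant in t: its time derivative vanishes identically. -/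
/-- The sum over a cycle of the discrete derivative of a function vanishes. -/
theorem ZMod.sum_sub_shift_eq_zero {N : ℕ} [NeZero N] {M : Type*} [AddCommGroup M]
    (G : ZMod N → M) : ∑ x, (G (x + 1) - G x) = 0 := by
  rw [Finset.sum_sub_distrib, sub_eq_zero]
  exact Equiv.sum_comp (Equiv.addRight (1 : ZMod N)) G

/-- Fix `N ≥ 3` and reals `α > 0`, `ν ≥ 0`. Let `q, p : ℝ → ℝ^{ℤ/Nℤ}` be
differentiable functions of time satisfying the harmonic Hamiltonian equations `q̇_x = p_x`
and `ṗ_x = 2α (q_{x+1} − 2 q_x + q_{x−1}) − 2ν q_x`. Then the total energy current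
`𝔍(t) = −α Σ_x (q_{x+1}(t) − q_x(t))(p_x(t) + p_{x+1}(t))` is constant in `t`: its time
derivative vanishes identically. -/
theorem stmt8 (N : ℕ) [NeZero N] (hN : 3 ≤ N)
    (α ν : ℝ) (hα : 0 < α) (hν : 0 ≤ ν)
    (q p : ℝ → ZMod N → ℝ)
    (hq : ∀ (t : ℝ) (x : ZMod N), HasDerivAt (fun s => q s x) (p t x) t)
    (hp : ∀ (t : ℝ) (x : ZMod N), HasDerivAt (fun s => p s x)
      (2 * α * (q t (x + 1) - 2 * q t x + q t (x - 1)) - 2 * ν * q t x) t)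
    (J : ℝ → ℝ)
    (hJ : ∀ t, J t = -α * ∑ x : ZMod N, (q t (x + 1) - q t x) * (p t x + p t (x + 1))) :
    ∀ t : ℝ, HasDerivAt J 0 t := by
  intro t
  have hsum := HasDerivAt.fun_sum (u := Finset.univ) fun (x : ZMod N) _ =>
    ((hq t (x + 1)).sub (hq t x)).mul ((hp t x).add (hp t (x + 1)))
  rw [funext hJ]
  refine (hsum.const_mul (-α)).congr_deriv ?_
  rw [← mul_zero (-α), ← ZMod.sum_sub_shift_eq_zero fun x : ZMod N =>
    p t x ^ 2 - 2 * ν * q t x ^ 2 + 2 * α * ((q t x - q t (x - 1)) * (q t (x + 1) - q t x))]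
  congr 1
  refine Finset.sum_congr rfl fun x _ => ?_
  simp only [Pi.add_apply, Pi.sub_apply, add_sub_cancel_right]
  ring
end

section
/- Fix a dimension d ≥ 2 and reals α > 0, ν ≥ 0, and assume d ≥ 3 or ν > 0. Then the function f : [0,1]^d → ℝ defined (for k with Σ_j sin²(π k_j) ≠ 0, and by 0 elsewhere) by f(k) = 4π² α² sin²(2π k_1) / [ ( ν + 4α Σ_{j=1}^d sin²(π k_j) ) · 8 Σ_{j=1}^d sin²(π k_j) ] is Lebesgue integrable on [0,1]^d. -/
open Real MeasureTheory

lemma min_le_sin_pi_mul {x : ℝ} (h0 : 0 ≤ x) (h1 : x ≤ 1) : min x (1 - x) ≤ sin (π * x) := by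
  have key : ∀ y : ℝ, 0 ≤ y → y ≤ 1 / 2 → y ≤ sin (π * y) := fun y hy hy' ↦ by
    have h := Real.mul_le_sin (x := π * y) (by positivity) (by nlinarith [pi_pos])
    have e : 2 / π * (π * y) = 2 * y := by field_simp
    linarith
  rcases le_total x (1 / 2) with h | h
  · exact (min_le_left _ _).trans (key x h0 h)
  · refine (min_le_right _ _).trans ((key (1 - x) (by linarith) (by linarith)).trans_eq ?_)
    rw [mul_sub, mul_one, sin_pi_sub]

lemma sin_sq_rpow_neg_le {x r : ℝ} (hr : 0 ≤ r) (h0 : 0 < x) (h1 : x < 1) :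
    (sin (π * x) ^ 2) ^ (-r) ≤ x ^ (-(2 * r)) + (1 - x) ^ (-(2 * r)) := by
  have key : ∀ y : ℝ, 0 < y → y ≤ sin (π * x) →
      (sin (π * x) ^ 2) ^ (-r) ≤ y ^ (-(2 * r)) := fun y hy hys ↦ by
    calc (sin (π * x) ^ 2) ^ (-r) ≤ (y ^ 2) ^ (-r) :=
          rpow_le_rpow_of_nonpos (by positivity) (by gcongr) (by linarith)
      _ = y ^ (-(2 * r)) := by
          rw [← rpow_natCast, ← rpow_mul hy.le]; congr 1; push_cast; ring
  have hx := min_le_sin_pi_mul h0.le h1.le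
  have h1' : 0 < 1 - x := by linarith
  have hp := rpow_nonneg h0.le (-(2 * r))
  have hq := rpow_nonneg h1'.le (-(2 * r))
  rcases min_le_iff.mp hx with h | h
  · linarith [key x h0 h]
  · linarith [key (1 - x) h1' h]

lemma integrableOn_rpow_add_one_sub_rpow {p : ℝ} (hp : -1 < p) :
    IntegrableOn (fun x : ℝ ↦ x ^ p + (1 - x) ^ p) (Set.Ioo 0 1) := by
  have h : IntervalIntegrable (fun x : ℝ ↦ x ^ p) volume 0 1 :=
    intervalIntegral.intervalIntegrable_rpow' hp
  have h' : IntervalIntegrable (fun x : ℝ ↦ (1 - x) ^ p) volume 0 1 := by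
    simpa using (h.comp_sub_left 1).symm
  exact (intervalIntegrable_iff_integrableOn_Ioo_of_le zero_le_one).mp (h.add h')

lemma inv_sum_le_prod_rpow_neg {d : ℕ} (hd : 1 ≤ d) (s : Fin d → ℝ) (hs : ∀ j, 0 < s j) :
    (∑ j, s j)⁻¹ ≤ ∏ j, s j ^ (-(1 / (d : ℝ))) := by
  have hd' : (1 : ℝ) ≤ d := by exact_mod_cast hd
  have h := Real.geom_mean_le_arith_mean_weighted Finset.univ (fun _ ↦ 1 / (d : ℝ)) s
    (fun _ _ ↦ by positivity) (by simp; field_simp) (fun j _ ↦ (hs j).le)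
  rw [← Finset.mul_sum] at h
  have hS : 0 ≤ ∑ j, s j := Finset.sum_nonneg fun j _ ↦ (hs j).le
  have hle : 1 / (d : ℝ) * ∑ j, s j ≤ ∑ j, s j :=
    mul_le_of_le_one_left hS ((div_le_one (by linarith)).mpr hd')
  calc (∑ j, s j)⁻¹ ≤ (∏ j, s j ^ (1 / (d : ℝ)))⁻¹ :=
        inv_anti₀ (Finset.prod_pos fun j _ ↦ rpow_pos_of_pos (hs j) _) (h.trans hle)
    _ = ∏ j, s j ^ (-(1 / (d : ℝ))) := by
        rw [← Finset.prod_inv_distrib]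
        exact Finset.prod_congr rfl fun j _ ↦ (rpow_neg (hs j).le _).symm

lemma sin_two_pi_mul_sq_le {d : ℕ} (k : Fin d → ℝ) (i : Fin d) :
    sin (2 * π * k i) ^ 2 ≤ 4 * ∑ j, sin (π * k j) ^ 2 := by
  have h : sin (π * k i) ^ 2 ≤ ∑ j, sin (π * k j) ^ 2 :=
    Finset.single_le_sum (f := fun j ↦ sin (π * k j) ^ 2) (fun j _ ↦ sq_nonneg _)
      (Finset.mem_univ i)
  rw [mul_assoc, sin_two_mul]
  nlinarith [sin_sq_add_cos_sq (π * k i), sq_nonneg (sin (π * k i)),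
    sq_nonneg (sin (π * k i) ^ 2)]

/-- Fix a dimension `d ≥ 2` and reals `α > 0`, `ν ≥ 0`, and assume `d ≥ 3`
or `ν > 0`. Then the function `f : [0,1]^d → ℝ` defined (for `k` with
`Σ_j sin²(π k_j) ≠ 0`, and by `0` elsewhere) by
`f(k) = 4π² α² sin²(2π k_1) / [ (ν + 4α Σ_j sin²(π k_j)) · 8 Σ_j sin²(π k_j) ]`
is Lebesgue integrable on `[0,1]^d`. -/
theorem stmt12 (d : ℕ) (hd : 2 ≤ d) (α ν : ℝ) (hα : 0 < α) (hν : 0 ≤ ν)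
    (hcase : 3 ≤ d ∨ 0 < ν)
    (f : (Fin d → ℝ) → ℝ)
    (hf : ∀ k : Fin d → ℝ, f k =
      if (∑ j : Fin d, Real.sin (π * k j) ^ 2) ≠ 0 then
        4 * π ^ 2 * α ^ 2 * Real.sin (2 * π * k ⟨0, by omega⟩) ^ 2 /
          ((ν + 4 * α * ∑ j : Fin d, Real.sin (π * k j) ^ 2) *
            (8 * ∑ j : Fin d, Real.sin (π * k j) ^ 2))
      else 0) :
    IntegrableOn f (Set.Icc (0 : Fin d → ℝ) 1) volume := by
  have hfm : Measurable f := by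
    rw [funext hf]
    refine Measurable.ite ?_ (by fun_prop) measurable_const
    exact (measurableSet_eq_fun (by fun_prop) measurable_const).compl
  have hf0 : ∀ k, 0 ≤ f k := fun k ↦ by
    rw [hf]
    split_ifs
    · positivity
    · exact le_rfl
  have hbound : ∀ k, ∀ c : ℝ, 0 < c → c ≤ ν + 4 * α * ∑ j, sin (π * k j) ^ 2 →
      f k ≤ 2 * π ^ 2 * α ^ 2 / c := fun k c hc hle ↦ by
    rw [hf]
    split_ifs with hS
    · have hS' : 0 < ∑ j, sin (π * k j) ^ 2 :=
        lt_of_le_of_ne (Finset.sum_nonneg fun j _ ↦ sq_nonneg _) (Ne.symm hS)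
      have hsin := sin_two_pi_mul_sq_le k ⟨0, by omega⟩
      calc _ ≤ 4 * π ^ 2 * α ^ 2 * (4 * ∑ j, sin (π * k j) ^ 2) /
              (c * (8 * ∑ j, sin (π * k j) ^ 2)) := by gcongr
        _ = 2 * π ^ 2 * α ^ 2 / c := by field_simp; norm_num
    · positivity
  rcases hν.lt_or_eq with hν' | hν'
  · refine Measure.integrableOn_of_bounded (M := 2 * π ^ 2 * α ^ 2 / ν)
      isCompact_Icc.measure_lt_top.ne hfm.aestronglyMeasurable (ae_of_all _ fun k ↦ ?_)
    rw [norm_of_nonneg (hf0 k)]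
    exact hbound k ν hν' (le_add_of_nonneg_right (by positivity))
  have hd3 : (3 : ℝ) ≤ d := by exact_mod_cast hcase.resolve_right hν'.symm.not_gt
  have hp : -1 < -(2 * (1 / (d : ℝ))) := by
    have : 2 * (1 / (d : ℝ)) < 1 := by rw [mul_one_div, div_lt_one] <;> linarith
    linarith
  have hcube : (Set.univ.pi fun _ : Fin d ↦ Set.Ioo (0 : ℝ) 1) =ᵐ[volume]
      Set.Icc (0 : Fin d → ℝ) 1 :=
    Measure.univ_pi_Ioo_ae_eq_Icc
  rw [← integrableOn_congr_set_ae hcube]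
  have hprod : IntegrableOn (fun k : Fin d → ℝ ↦
      ∏ j, (k j ^ (-(2 * (1 / (d : ℝ)))) + (1 - k j) ^ (-(2 * (1 / (d : ℝ))))))
      (Set.univ.pi fun _ ↦ Set.Ioo (0 : ℝ) 1) := by
    rw [IntegrableOn, volume_pi, Measure.restrict_pi_pi]
    exact Integrable.fintype_prod fun _ ↦ integrableOn_rpow_add_one_sub_rpow hp
  refine (hprod.const_mul (2 * π ^ 2 * α ^ 2 / (4 * α))).mono' hfm.aestronglyMeasurable ?_
  refine (ae_restrict_iff' (MeasurableSet.univ_pi fun _ ↦ measurableSet_Ioo)).mpr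
    (ae_of_all _ fun k hk ↦ ?_)
  have hk' : ∀ j, 0 < k j ∧ k j < 1 := fun j ↦ hk j (Set.mem_univ j)
  have hs : ∀ j, 0 < sin (π * k j) ^ 2 := fun j ↦ by
    have := sin_pos_of_pos_of_lt_pi (mul_pos pi_pos (hk' j).1)
      (mul_lt_of_lt_one_right pi_pos (hk' j).2)
    positivity
  have hS : 0 < ∑ j, sin (π * k j) ^ 2 :=
    Finset.sum_pos (fun j _ ↦ hs j) ⟨⟨0, by omega⟩, Finset.mem_univ _⟩
  rw [norm_of_nonneg (hf0 k)]
  calc f k ≤ 2 * π ^ 2 * α ^ 2 / (4 * α * ∑ j, sin (π * k j) ^ 2) :=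
        hbound k _ (by positivity) (le_add_of_nonneg_left hν)
    _ = 2 * π ^ 2 * α ^ 2 / (4 * α) * (∑ j, sin (π * k j) ^ 2)⁻¹ := by
        rw [← div_div, div_eq_mul_inv _ (∑ j, sin (π * k j) ^ 2)]
    _ ≤ _ := by
        gcongr
        refine (inv_sum_le_prod_rpow_neg (by omega) _ hs).trans ?_
        exact Finset.prod_le_prod (fun j _ ↦ rpow_nonneg (hs j).le _) fun j _ ↦
          sin_sq_rpow_neg_le (by positivity) (hk' j).1 (hk' j).2
end

section
/- Fix reals α > 0 and ν > 0. Then the function f : [0,1] → ℝ defined (for k with sin(π k) ≠ 0, and by 0 elsewhere) by f(k) = 4π² α² sin²(2π k) / [ ( ν + 4α sin²(π k) ) · (4/3) sin²(π k) (1 + 2 cos²(π k)) ] is Lebesgue integrable on [0,1]. -/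
open Real MeasureTheory

/-- Fix reals `α > 0` and `ν > 0`. Then the function `f : [0,1] → ℝ`
defined (for `k` with `sin(π k) ≠ 0`, and by `0` elsewhere) by
`f(k) = 4π² α² sin²(2π k) / [ (ν + 4α sin²(π k)) · (4/3) sin²(π k)(1 + 2 cos²(π k)) ]`
is Lebesgue integrable on `[0,1]`. -/
theorem stmt13 (α ν : ℝ) (hα : 0 < α) (hν : 0 < ν)
    (f : ℝ → ℝ)
    (hf : ∀ k : ℝ, f k =
      if Real.sin (π * k) ≠ 0 then
        4 * π ^ 2 * α ^ 2 * Real.sin (2 * π * k) ^ 2 /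
          ((ν + 4 * α * Real.sin (π * k) ^ 2) *
            ((4 / 3) * Real.sin (π * k) ^ 2 * (1 + 2 * Real.cos (π * k) ^ 2)))
      else 0) :
    IntegrableOn f (Set.Icc (0 : ℝ) 1) volume := by
  have hden₁ : ∀ k : ℝ, ν + 4 * α * Real.sin (π * k) ^ 2 ≠ 0 := fun k => by positivity
  have hden₂ : ∀ k : ℝ, 1 + 2 * Real.cos (π * k) ^ 2 ≠ 0 := fun k => by positivity
  -- Cancelling `sin² (π k)` gives a continuous function that agrees with `f` on `(0, 1)`.
  have hcont : Continuous fun k : ℝ => 12 * π ^ 2 * α ^ 2 * Real.cos (π * k) ^ 2 /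
      ((ν + 4 * α * Real.sin (π * k) ^ 2) * (1 + 2 * Real.cos (π * k) ^ 2)) :=
    Continuous.div (by fun_prop) (by fun_prop) fun k => mul_ne_zero (hden₁ k) (hden₂ k)
  rw [integrableOn_Icc_iff_integrableOn_Ioo]
  refine (hcont.integrableOn_Icc.mono_set Set.Ioo_subset_Icc_self).congr_fun ?_ measurableSet_Ioo
  intro k hk
  have hsin : Real.sin (π * k) ≠ 0 :=
    (Real.sin_pos_of_pos_of_lt_pi (mul_pos pi_pos hk.1) (mul_lt_of_lt_one_right pi_pos hk.2)).ne'
  have h₁ := hden₁ k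
  have h₂ := hden₂ k
  simp only [hf, if_pos hsin, mul_assoc 2 π k, Real.sin_two_mul]
  field_simp
  ring
end

section
/- Fix α > 0. The function f : [0,1]² → ℝ defined (for k = (k_1,k_2) with sin²(π k_1) + sin²(π k_2) ≠ 0, and by 0 elsewhere) by f(k) = 4π² α² sin²(2π k_1) / [ 4α ( sin²(π k_1) + sin²(π k_2) ) · 8 ( sin²(π k_1) + sin²(π k_2) ) ] is NOT Lebesgue integrable on [0,1]². -/
open Real MeasureTheory

/-- The function `x⁻²` is not integrable on the triangle `0 < y ≤ x < 1/4`. -/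
lemma not_integrableOn_inv_sq_triangle :
    ¬ IntegrableOn (fun p : ℝ × ℝ => (p.1 ^ 2)⁻¹)
      {p : ℝ × ℝ | (0 < p.1 ∧ p.1 < 1 / 4) ∧ 0 < p.2 ∧ p.2 ≤ p.1} (volume.prod volume) := by
  intro h
  have hT : MeasurableSet {p : ℝ × ℝ | (0 < p.1 ∧ p.1 < 1 / 4) ∧ 0 < p.2 ∧ p.2 ≤ p.1} := by
    measurability
  have h1 := ((integrable_indicator_iff hT).2 h).integral_prod_left
  have h2 : (fun x : ℝ => ∫ y : ℝ,
      {p : ℝ × ℝ | (0 < p.1 ∧ p.1 < 1 / 4) ∧ 0 < p.2 ∧ p.2 ≤ p.1}.indicator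
        (fun p : ℝ × ℝ => (p.1 ^ 2)⁻¹) (x, y)) =
      (Set.Ioo (0 : ℝ) (1 / 4)).indicator fun x => x⁻¹ := by
    funext x
    by_cases hx : x ∈ Set.Ioo (0 : ℝ) (1 / 4)
    · have hslice : (fun y : ℝ =>
          {p : ℝ × ℝ | (0 < p.1 ∧ p.1 < 1 / 4) ∧ 0 < p.2 ∧ p.2 ≤ p.1}.indicator
            (fun p : ℝ × ℝ => (p.1 ^ 2)⁻¹) (x, y)) =
          (Set.Ioc 0 x).indicator fun _ => (x ^ 2)⁻¹ := by
        funext y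
        simp [Set.indicator_apply, hx.1, show x < 4⁻¹ by linarith [hx.2]]
      have hx0 := hx.1
      rw [hslice, integral_indicator measurableSet_Ioc, Set.indicator_of_mem hx]
      simp [hx0.le]
      field_simp
    · rw [Set.indicator_of_notMem hx]
      have hslice (y : ℝ) : (x, y) ∉
          {p : ℝ × ℝ | (0 < p.1 ∧ p.1 < 1 / 4) ∧ 0 < p.2 ∧ p.2 ≤ p.1} := fun hy => hx hy.1
      simp only [Set.indicator_of_notMem (hslice _), integral_zero]
  rw [h2, integrable_indicator_iff measurableSet_Ioo, ← integrableOn_Ioc_iff_integrableOn_Ioo,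
    ← intervalIntegrable_iff_integrableOn_Ioc_of_le (by norm_num), intervalIntegrable_inv_iff] at h1
  norm_num at h1

/-- Near the origin, for `0 < y ≤ x`, the integrand dominates a multiple of `x⁻²`. -/
lemma inv_sq_le_integrand {α x y : ℝ} (hα : 0 < α) (hx : 0 < x) (hx' : x < 1 / 4)
    (hy : 0 < y) (hyx : y ≤ x) :
    α / (2 * π ^ 2) * (x ^ 2)⁻¹ ≤
      4 * π ^ 2 * α ^ 2 * sin (2 * π * x) ^ 2 /
        ((4 * α * (sin (π * x) ^ 2 + sin (π * y) ^ 2)) *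
          (8 * (sin (π * x) ^ 2 + sin (π * y) ^ 2))) := by
  have hπ := pi_pos
  have hsx : 0 < sin (π * x) := sin_pos_of_pos_of_lt_pi (by positivity) (by nlinarith)
  have hsx' : sin (π * x) ≤ π * x := sin_le (by positivity)
  have hsy : 0 < sin (π * y) := sin_pos_of_pos_of_lt_pi (by positivity) (by nlinarith)
  have hsy' : sin (π * y) ≤ π * x := (sin_le (by positivity)).trans (by gcongr)
  have hs2 : 4 * x ≤ sin (2 * π * x) := by
    have := mul_le_sin (x := 2 * π * x) (by positivity) (by nlinarith)
    calc 4 * x = 2 / π * (2 * π * x) := by field_simp; norm_num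
      _ ≤ _ := this
  have hsum : sin (π * x) ^ 2 + sin (π * y) ^ 2 ≤ 2 * (π * x) ^ 2 := by
    have h1 : sin (π * x) ^ 2 ≤ (π * x) ^ 2 := by gcongr
    have h2 : sin (π * y) ^ 2 ≤ (π * x) ^ 2 := by gcongr
    linarith
  calc α / (2 * π ^ 2) * (x ^ 2)⁻¹ =
      4 * π ^ 2 * α ^ 2 * (4 * x) ^ 2 /
        ((4 * α * (2 * (π * x) ^ 2)) * (8 * (2 * (π * x) ^ 2))) := by
        field_simp
        norm_num
    _ ≤ _ := by gcongr

/-- Fix `α > 0`. The function `f : [0,1]² → ℝ` defined (for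
`k = (k_1,k_2)` with `sin²(π k_1) + sin²(π k_2) ≠ 0`, and by `0` elsewhere) by
`f(k) = 4π² α² sin²(2π k_1) / [ 4α (sin²(π k_1) + sin²(π k_2)) · 8 (sin²(π k_1) + sin²(π k_2)) ]`
is NOT Lebesgue integrable on `[0,1]²`. -/
theorem stmt14 (α : ℝ) (hα : 0 < α)
    (f : (Fin 2 → ℝ) → ℝ)
    (hf : ∀ k : Fin 2 → ℝ, f k =
      if Real.sin (π * k 0) ^ 2 + Real.sin (π * k 1) ^ 2 ≠ 0 then
        4 * π ^ 2 * α ^ 2 * Real.sin (2 * π * k 0) ^ 2 /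
          ((4 * α * (Real.sin (π * k 0) ^ 2 + Real.sin (π * k 1) ^ 2)) *
            (8 * (Real.sin (π * k 0) ^ 2 + Real.sin (π * k 1) ^ 2)))
      else 0) :
    ¬ IntegrableOn f (Set.Icc (0 : Fin 2 → ℝ) 1) volume := by
  intro h
  have hmp := (volume_preserving_finTwoArrow ℝ).symm
  have h1 := (hmp.integrableOn_comp_preimage
    (MeasurableEquiv.finTwoArrow (α := ℝ)).symm.measurableEmbedding).2 h
  set T := {p : ℝ × ℝ | (0 < p.1 ∧ p.1 < 1 / 4) ∧ 0 < p.2 ∧ p.2 ≤ p.1}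
  have hTm : MeasurableSet T := by measurability
  have h2 : IntegrableOn (f ∘ (MeasurableEquiv.finTwoArrow (α := ℝ)).symm) T := by
    refine h1.mono_set ?_
    rintro ⟨x, y⟩ ⟨⟨hx, hx'⟩, hy, hyx⟩
    dsimp only at hx hx' hy hyx
    constructor <;> intro i <;> fin_cases i <;> simp [MeasurableEquiv.finTwoArrow] <;> linarith
  have hc : 0 < α / (2 * π ^ 2) := by positivity
  have h3 : IntegrableOn (fun p : ℝ × ℝ => α / (2 * π ^ 2) * (p.1 ^ 2)⁻¹) T := by
    refine Integrable.mono' h2 (by fun_prop) ((ae_restrict_iff' hTm).2 (.of_forall ?_))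
    rintro ⟨x, y⟩ ⟨⟨hx, hx'⟩, hy, hyx⟩
    dsimp only at hx hx' hy hyx
    have hs : 0 < sin (π * x) :=
      sin_pos_of_pos_of_lt_pi (by positivity) (by nlinarith [pi_pos])
    rw [norm_of_nonneg (by positivity)]
    refine (inv_sq_le_integrand hα hx hx' hy hyx).trans_eq ?_
    simp only [Function.comp_apply, hf]
    rw [if_pos]
    · rfl
    · exact (add_pos_of_pos_of_nonneg (pow_pos hs 2) (sq_nonneg _)).ne'
  refine not_integrableOn_inv_sq_triangle ?_
  exact (integrable_const_mul_iff hc.ne'.isUnit _).1 h3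
end

section
/- Fix α > 0. The function f : [0,1] → ℝ defined (for k with sin(π k) ≠ 0, and by 0 elsewhere) by f(k) = 4π² α² sin²(2π k) / [ 4α sin²(π k) · (4/3) sin²(π k) (1 + 2 cos²(π k)) ] is NOT Lebesgue integrable on [0,1]. -/
open Real MeasureTheory

/-- Away from the zeros of the sine, the conductivity integrand is
`3 π² α cos² (π k) / (sin² (π k) (1 + 2 cos² (π k)))`, so it dominates `α / (2 k²)` as soon as
`cos² (π k) ≥ 1 / 2`. -/
lemma div_two_mul_sq_le_conductivity_integrand {α k : ℝ} (hα : 0 < α)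
    (hs : Real.sin (π * k) ≠ 0) (hc : 1 / 2 ≤ Real.cos (π * k) ^ 2) :
    α / (2 * k ^ 2) ≤
      4 * π ^ 2 * α ^ 2 * Real.sin (2 * π * k) ^ 2 /
        ((4 * α * Real.sin (π * k) ^ 2) *
          ((4 / 3) * Real.sin (π * k) ^ 2 * (1 + 2 * Real.cos (π * k) ^ 2))) := by
  have hk : k ≠ 0 := by
    rintro rfl
    simp at hs
  have hk2 : 0 < k ^ 2 := by positivity
  have hs2 : 0 < Real.sin (π * k) ^ 2 := by positivity
  have hsin : Real.sin (π * k) ^ 2 ≤ π ^ 2 * k ^ 2 := by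
    rw [← mul_pow]
    exact sq_le_sq.2 Real.abs_sin_le_abs
  rw [mul_assoc 2 π k, Real.sin_two_mul]
  generalize Real.sin (π * k) = s at *
  generalize Real.cos (π * k) = c at *
  have hsimp : 4 * π ^ 2 * α ^ 2 * (2 * s * c) ^ 2 /
      ((4 * α * s ^ 2) * ((4 / 3) * s ^ 2 * (1 + 2 * c ^ 2))) =
      3 * π ^ 2 * α * c ^ 2 / (s ^ 2 * (1 + 2 * c ^ 2)) := by
    field_simp
    ring
  rw [hsimp, div_le_div_iff₀ (by positivity) (by positivity)]
  calc α * (s ^ 2 * (1 + 2 * c ^ 2))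
      ≤ α * (π ^ 2 * k ^ 2 * (6 * c ^ 2)) := by
        gcongr
        linarith
    _ = 3 * π ^ 2 * α * c ^ 2 * (2 * k ^ 2) := by ring

/-- Fix `α > 0`. The function `f : [0,1] → ℝ` defined (for `k` with
`sin(π k) ≠ 0`, and by `0` elsewhere) by
`f(k) = 4π² α² sin²(2π k) / [ 4α sin²(π k) · (4/3) sin²(π k)(1 + 2 cos²(π k)) ]`
is NOT Lebesgue integrable on `[0,1]`. -/
theorem stmt15 (α : ℝ) (hα : 0 < α)
    (f : ℝ → ℝ)
    (hf : ∀ k : ℝ, f k =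
      if Real.sin (π * k) ≠ 0 then
        4 * π ^ 2 * α ^ 2 * Real.sin (2 * π * k) ^ 2 /
          ((4 * α * Real.sin (π * k) ^ 2) *
            ((4 / 3) * Real.sin (π * k) ^ 2 * (1 + 2 * Real.cos (π * k) ^ 2)))
      else 0) :
    ¬ IntegrableOn f (Set.Icc (0 : ℝ) 1) volume := by
  have hO : (fun k : ℝ => (k - 0)⁻¹) =O[nhdsWithin 0 {0}ᶜ] f := by
    have hcos : ∀ᶠ k : ℝ in nhds 0, 1 / 2 < Real.cos (π * k) ^ 2 := by
      have hcont : ContinuousAt (fun k : ℝ => Real.cos (π * k) ^ 2) 0 := by fun_prop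
      exact hcont.eventually_const_lt (by norm_num)
    refine Asymptotics.IsBigO.of_bound (2 / α) ?_
    filter_upwards [self_mem_nhdsWithin, nhdsWithin_le_nhds hcos,
      nhdsWithin_le_nhds (Ioo_mem_nhds (show (-1 : ℝ) < 0 by norm_num) zero_lt_one)]
      with k hk0 hc hk
    have hk0' : k ≠ 0 := hk0
    have hs : Real.sin (π * k) ≠ 0 := by
      rw [Ne, Real.sin_eq_zero_iff_of_lt_of_lt (by nlinarith [Real.pi_pos, hk.1])
        (by nlinarith [Real.pi_pos, hk.2])]
      positivity
    have hle := div_two_mul_sq_le_conductivity_integrand hα hs hc.le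
    rw [← (hf k).trans (if_pos hs)] at hle
    have hkpos : 0 < |k| := abs_pos.2 hk0'
    have hk1 : |k| ≤ 1 := (abs_lt.2 hk).le
    calc ‖(k - 0)⁻¹‖ = |k|⁻¹ := by rw [sub_zero, norm_inv, Real.norm_eq_abs]
      _ ≤ (|k| ^ 2)⁻¹ := inv_anti₀ (by positivity) (by nlinarith)
      _ = 2 / α * (α / (2 * k ^ 2)) := by
        rw [sq_abs]
        field_simp
      _ ≤ 2 / α * ‖f k‖ := by
        gcongr
        exact hle.trans (Real.le_norm_self _)
  rw [← intervalIntegrable_iff_integrableOn_Icc_of_le zero_le_one]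
  exact not_intervalIntegrable_of_sub_inv_isBigO_punctured hO zero_ne_one Set.left_mem_uIcc
end

section
/- Fix reals α > 0 and γ > 0, and define for λ > 0 the integral F(λ) = ∫_0^1 4π² α cos²(π k) / ( λ + γ (4/3) sin²(π k) (1 + 2 cos²(π k)) ) dk. Then there exist constants 0 < c ≤ C such that for every λ ∈ (0,1], c λ^{−1/2} ≤ F(λ) ≤ C λ^{−1/2}. -/
open Real MeasureTheory

lemma integral_inv_sq_add_sq_le {s m : ℝ} (hs : 0 < s) (hm : 0 < m) :
    ∫ k in (0 : ℝ)..1, (s ^ 2 + m ^ 2 * k ^ 2)⁻¹ ≤ π / (2 * m * s) := by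
  have hscale : ∀ k : ℝ,
      (s ^ 2 + m ^ 2 * k ^ 2)⁻¹ = (s ^ 2)⁻¹ * (1 + (m / s * k) ^ 2)⁻¹ := by
    intro k
    rw [← mul_inv]
    congr 1
    field_simp
  simp_rw [hscale]
  rw [intervalIntegral.integral_const_mul,
    intervalIntegral.integral_comp_mul_left (fun x => (1 + x ^ 2)⁻¹) (by positivity),
    integral_inv_one_add_sq, smul_eq_mul, mul_zero, arctan_zero, sub_zero]
  calc (s ^ 2)⁻¹ * ((m / s)⁻¹ * arctan (m / s * 1))
      ≤ (s ^ 2)⁻¹ * ((m / s)⁻¹ * (π / 2)) := by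
        gcongr
        exact (arctan_lt_pi_div_two _).le
    _ = π / (2 * m * s) := by field_simp

lemma two_mul_le_sin_pi_mul {k : ℝ} (h0 : 0 ≤ k) (h1 : k ≤ 1 / 2) : 2 * k ≤ sin (π * k) := by
  have h := mul_le_sin (x := π * k) (by positivity) (by nlinarith [pi_pos])
  have he : 2 / π * (π * k) = 2 * k := by field_simp
  rwa [he] at h

lemma inv_sq_add_sin_sq_le {s b k : ℝ} (hs : 0 < s) (h0 : 0 ≤ k) (h1 : k ≤ 1) :
    (s ^ 2 + b ^ 2 * sin (π * k) ^ 2)⁻¹ ≤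
      (s ^ 2 + (2 * b) ^ 2 * k ^ 2)⁻¹ + (s ^ 2 + (2 * b) ^ 2 * (1 - k) ^ 2)⁻¹ := by
  have key : ∀ x : ℝ, 0 ≤ x → 2 * x ≤ sin (π * k) →
      (s ^ 2 + b ^ 2 * sin (π * k) ^ 2)⁻¹ ≤ (s ^ 2 + (2 * b) ^ 2 * x ^ 2)⁻¹ := by
    intro x hx h
    have he : (2 * b) ^ 2 * x ^ 2 = b ^ 2 * (2 * x) ^ 2 := by ring
    rw [he]
    gcongr
  rcases le_total k (1 / 2) with h | h
  · exact (key k h0 (two_mul_le_sin_pi_mul h0 h)).trans (le_add_of_nonneg_right (by positivity))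
  · have hsin : sin (π * (1 - k)) = sin (π * k) := by
      rw [mul_sub, mul_one, sin_pi_sub]
    refine (key (1 - k) (by linarith) ?_).trans (le_add_of_nonneg_left (by positivity))
    rw [← hsin]
    exact two_mul_le_sin_pi_mul (by linarith) (by linarith)

lemma integral_inv_sq_add_sin_sq_le {s b : ℝ} (hs : 0 < s) (hb : 0 < b) :
    ∫ k in (0 : ℝ)..1, (s ^ 2 + b ^ 2 * sin (π * k) ^ 2)⁻¹ ≤ π / (2 * b * s) := by
  have hc₀ : Continuous fun k : ℝ => (s ^ 2 + b ^ 2 * sin (π * k) ^ 2)⁻¹ :=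
    Continuous.inv₀ (by fun_prop) fun k => by positivity
  have hc₁ : Continuous fun k : ℝ => (s ^ 2 + (2 * b) ^ 2 * k ^ 2)⁻¹ :=
    Continuous.inv₀ (by fun_prop) fun k => by positivity
  have hc₂ : Continuous fun k : ℝ => (s ^ 2 + (2 * b) ^ 2 * (1 - k) ^ 2)⁻¹ :=
    hc₁.comp (by fun_prop : Continuous fun k : ℝ => 1 - k)
  have hrefl := intervalIntegral.integral_comp_sub_left (a := 0) (b := 1)
    (fun k : ℝ => (s ^ 2 + (2 * b) ^ 2 * k ^ 2)⁻¹) 1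
  simp only [sub_self, sub_zero] at hrefl
  have hbound := integral_inv_sq_add_sq_le hs (mul_pos two_pos hb)
  calc ∫ k in (0 : ℝ)..1, (s ^ 2 + b ^ 2 * sin (π * k) ^ 2)⁻¹
      ≤ ∫ k in (0 : ℝ)..1,
          ((s ^ 2 + (2 * b) ^ 2 * k ^ 2)⁻¹ + (s ^ 2 + (2 * b) ^ 2 * (1 - k) ^ 2)⁻¹) :=
        intervalIntegral.integral_mono_on zero_le_one (hc₀.intervalIntegrable _ _)
          ((hc₁.add hc₂).intervalIntegrable _ _)
          fun k hk => inv_sq_add_sin_sq_le hs hk.1 hk.2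
    _ ≤ π / (2 * (2 * b) * s) + π / (2 * (2 * b) * s) := by
        rw [intervalIntegral.integral_add (hc₁.intervalIntegrable _ _)
          (hc₂.intervalIntegrable _ _), hrefl]
        exact add_le_add hbound hbound
    _ = π / (2 * b * s) := by
        field_simp
        norm_num

lemma le_integrand_of_le_quarter {α gam s k : ℝ} (hα : 0 < α) (hgam : 0 < gam) (hs : 0 < s)
    (hs1 : s ≤ 1) (h0 : 0 ≤ k) (hk : k ≤ s / 4) :
    2 * π ^ 2 * α / ((1 + gam * π ^ 2 / 4) * s ^ 2) ≤
      4 * π ^ 2 * α * cos (π * k) ^ 2 /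
        (s ^ 2 + gam * ((4 / 3) * sin (π * k) ^ 2 * (1 + 2 * cos (π * k) ^ 2))) := by
  have hcos : 1 / 2 ≤ cos (π * k) ^ 2 := by
    have h : 0 ≤ cos (2 * (π * k)) :=
      cos_nonneg_of_mem_Icc ⟨by nlinarith [pi_pos, mul_nonneg pi_pos.le h0],
        by nlinarith [pi_pos]⟩
    rw [cos_two_mul] at h
    linarith
  have hsin : sin (π * k) ^ 2 ≤ π ^ 2 * s ^ 2 / 16 := by
    have hnn : 0 ≤ sin (π * k) :=
      sin_nonneg_of_nonneg_of_le_pi (by positivity) (by nlinarith [pi_pos])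
    calc sin (π * k) ^ 2 ≤ (π * (s / 4)) ^ 2 := by
          gcongr
          exact (sin_le (by positivity)).trans (by gcongr)
      _ = π ^ 2 * s ^ 2 / 16 := by ring
  have hψ : (4 / 3) * sin (π * k) ^ 2 * (1 + 2 * cos (π * k) ^ 2) ≤ π ^ 2 / 4 * s ^ 2 := by
    nlinarith [cos_sq_le_one (π * k), sq_nonneg (sin (π * k))]
  apply div_le_div₀ (by positivity)
  · nlinarith [mul_pos (pow_pos pi_pos 2) hα]
  · positivity
  · nlinarith [mul_le_mul_of_nonneg_left hψ hgam.le]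

/-- Fix reals `α > 0` and `γ > 0`, and define for `λ > 0` the integral
`F(λ) = ∫_0^1 4π² α cos²(π k) / (λ + γ (4/3) sin²(π k)(1 + 2 cos²(π k))) dk`. Then there
exist constants `0 < c ≤ C` such that for every `λ ∈ (0,1]`,
`c λ^{−1/2} ≤ F(λ) ≤ C λ^{−1/2}`. -/
theorem stmt16 (α gam : ℝ) (hα : 0 < α) (hgam : 0 < gam)
    (F : ℝ → ℝ)
    (hF : ∀ lam : ℝ, 0 < lam → F lam =
      ∫ k in Set.Icc (0 : ℝ) 1,
        4 * π ^ 2 * α * Real.cos (π * k) ^ 2 /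
          (lam + gam * ((4 / 3) * Real.sin (π * k) ^ 2 * (1 + 2 * Real.cos (π * k) ^ 2)))) :
    ∃ c C : ℝ, 0 < c ∧ c ≤ C ∧
      ∀ lam ∈ Set.Ioc (0 : ℝ) 1,
        c * lam ^ (-(1 : ℝ) / 2) ≤ F lam ∧ F lam ≤ C * lam ^ (-(1 : ℝ) / 2) := by
  set c : ℝ := π ^ 2 * α / (2 * (1 + gam * π ^ 2 / 4)) with hc
  set b : ℝ := √(4 / 3 * gam)
  have hbpos : 0 < b := by positivity
  have hbsq : b ^ 2 = 4 / 3 * gam := sq_sqrt (by positivity)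
  set D : ℝ := 4 * π ^ 2 * α * (π / (2 * b)) with hD
  refine ⟨c, max c D, by positivity, le_max_left _ _, fun lam hlam => ?_⟩
  obtain ⟨s, hs, rfl⟩ : ∃ s : ℝ, 0 < s ∧ s ^ 2 = lam :=
    ⟨√lam, sqrt_pos.2 hlam.1, sq_sqrt hlam.1.le⟩
  have hs1 : s ≤ 1 := by nlinarith [hlam.2]
  have hpow : (s ^ 2) ^ (-(1 : ℝ) / 2) = s⁻¹ := by
    rw [← rpow_natCast_mul hs.le]
    norm_num [rpow_neg_one]
  rw [hF _ hlam.1, hpow, integral_Icc_eq_integral_Ioc,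
    ← intervalIntegral.integral_of_le zero_le_one]
  set f : ℝ → ℝ := fun k => 4 * π ^ 2 * α * cos (π * k) ^ 2 /
    (s ^ 2 + gam * ((4 / 3) * sin (π * k) ^ 2 * (1 + 2 * cos (π * k) ^ 2)))
  have hfc : Continuous f :=
    Continuous.div (by fun_prop) (by fun_prop) fun k => by positivity
  have hfnn : ∀ k, 0 ≤ f k := fun k => by positivity
  constructor
  · calc c * s⁻¹
        = ∫ _ in (0 : ℝ)..(s / 4), 2 * π ^ 2 * α / ((1 + gam * π ^ 2 / 4) * s ^ 2) := by
          rw [intervalIntegral.integral_const, smul_eq_mul, sub_zero, hc]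
          field_simp
          norm_num
      _ ≤ ∫ k in (0 : ℝ)..(s / 4), f k :=
          intervalIntegral.integral_mono_on (by positivity) (by simp)
            (hfc.intervalIntegrable _ _)
            fun k hk => le_integrand_of_le_quarter hα hgam hs hs1 hk.1 hk.2
      _ ≤ ∫ k in (0 : ℝ)..1, f k :=
          intervalIntegral.integral_mono_interval le_rfl (by positivity) (by linarith)
            (Filter.Eventually.of_forall hfnn) (hfc.intervalIntegrable _ _)
  · have hgc : Continuous fun k : ℝ => (s ^ 2 + b ^ 2 * sin (π * k) ^ 2)⁻¹ :=
      Continuous.inv₀ (by fun_prop) fun k => by positivity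
    calc ∫ k in (0 : ℝ)..1, f k
        ≤ ∫ k in (0 : ℝ)..1, 4 * π ^ 2 * α * (s ^ 2 + b ^ 2 * sin (π * k) ^ 2)⁻¹ := by
          refine intervalIntegral.integral_mono_on zero_le_one (hfc.intervalIntegrable _ _)
            ((hgc.const_mul _).intervalIntegrable _ _) fun k _ => ?_
          rw [← div_eq_mul_inv, hbsq]
          apply div_le_div₀ (by positivity)
          · exact mul_le_of_le_one_right (by positivity) (cos_sq_le_one _)
          · positivity
          · have : 0 ≤ gam * (sin (π * k) ^ 2 * cos (π * k) ^ 2) := by positivity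
            nlinarith
      _ ≤ 4 * π ^ 2 * α * (π / (2 * b * s)) := by
          rw [intervalIntegral.integral_const_mul]
          gcongr
          exact integral_inv_sq_add_sin_sq_le hs hbpos
      _ = D * s⁻¹ := by
          rw [hD]
          field_simp
      _ ≤ max c D * s⁻¹ := by
          gcongr
          exact le_max_right _ _
end

section
/- Fix an integer N ≥ 3 and a twice differentiable function V : ℝ → ℝ. For smooth functions f of (q,p) ∈ ℝ^{ℤ/Nℤ} × ℝ^{ℤ/Nℤ}, define the Liouville operator of the unpinned chain by (𝒜 f)(q,p) = Σ_{x ∈ ℤ/Nℤ} [ p_x ∂f/∂q_x + ( V'(q_{x+1} − q_x) − V'(q_x − q_{x−1}) ) ∂f/∂p_x ]. Let 𝔍(q,p) = −(1/2) Σ_{x ∈ ℤ/Nℤ} V'(q_{x+1} − q_x)(p_x + p_{x+1}). Then, writing r_x = q_{x+1} − q_x, one has the identity (𝒜 𝔍)(q,p) = −(1/2) Σ_{x ∈ ℤ/Nℤ} p_x² ( V''(r_{x−1}) − V''(r_x) ) for all (q,p). -/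
/-- A continuous linear functional on a product of two finite coordinate spaces is determined by
its values on the coordinate vectors. -/
theorem ContinuousLinearMap.sum_single_prod {ι : Type*} [Fintype ι] [DecidableEq ι]
    (L : ((ι → ℝ) × (ι → ℝ)) →L[ℝ] ℝ) (u v : ι → ℝ) :
    ∑ x, (u x * L (Pi.single x 1, 0) + v x * L (0, Pi.single x 1)) = L (u, v) := by
  have hu := (L.toLinearMap ∘ₗ LinearMap.inl ℝ (ι → ℝ) (ι → ℝ)).pi_apply_eq_sum_univ u
  have hv := (L.toLinearMap ∘ₗ LinearMap.inr ℝ (ι → ℝ) (ι → ℝ)).pi_apply_eq_sum_univ v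
  have hsingle : ∀ x : ι, (fun j => if x = j then (1 : ℝ) else 0) = Pi.single x 1 := by
    intro x
    ext j
    simp [Pi.single_apply, eq_comm]
  simp only [LinearMap.comp_apply, LinearMap.inl_apply, LinearMap.inr_apply,
    ContinuousLinearMap.coe_coe, smul_eq_mul, hsingle] at hu hv
  rw [Finset.sum_add_distrib, ← hu, ← hv, ← map_add]
  simp

/-- The derivative of the total energy current of a chain with force `g` in the direction
`(u, v)`. -/
theorem fderiv_energyCurrent_apply {N : ℕ} [NeZero N] {g : ℝ → ℝ} (hg : Differentiable ℝ g)
    (qp : (ZMod N → ℝ) × (ZMod N → ℝ)) (u v : ZMod N → ℝ) :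
    fderiv ℝ (fun qp : (ZMod N → ℝ) × (ZMod N → ℝ) =>
      -(1 / 2) * ∑ x, g (qp.1 (x + 1) - qp.1 x) * (qp.2 x + qp.2 (x + 1))) qp (u, v) =
    -(1 / 2) * ∑ x, (deriv g (qp.1 (x + 1) - qp.1 x) * (u (x + 1) - u x) *
        (qp.2 x + qp.2 (x + 1)) + g (qp.1 (x + 1) - qp.1 x) * (v x + v (x + 1))) := by
  have hq : ∀ x, HasFDerivAt (fun qp : (ZMod N → ℝ) × (ZMod N → ℝ) => qp.1 x)
      ((ContinuousLinearMap.proj x).comp (ContinuousLinearMap.fst ℝ _ _)) qp := fun x =>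
    (ContinuousLinearMap.proj (R := ℝ) (φ := fun _ : ZMod N => ℝ) x).hasFDerivAt.comp qp
      hasFDerivAt_fst
  have hp : ∀ x, HasFDerivAt (fun qp : (ZMod N → ℝ) × (ZMod N → ℝ) => qp.2 x)
      ((ContinuousLinearMap.proj x).comp (ContinuousLinearMap.snd ℝ _ _)) qp := fun x =>
    (ContinuousLinearMap.proj (R := ℝ) (φ := fun _ : ZMod N => ℝ) x).hasFDerivAt.comp qp
      hasFDerivAt_snd
  have hJ := (HasFDerivAt.fun_sum fun x (_ : x ∈ Finset.univ) =>
    ((hg (qp.1 (x + 1) - qp.1 x)).hasDerivAt.comp_hasFDerivAt qp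
      ((hq (x + 1)).sub (hq x))).mul ((hp x).add (hp (x + 1)))).const_mul (-(1 / 2) : ℝ)
  refine (DFunLike.congr_fun hJ.fderiv (u, v)).trans ?_
  simp only [smul_apply, _root_.sum_apply, _root_.add_apply,
    _root_.sub_apply, ContinuousLinearMap.comp_apply,
    ContinuousLinearMap.proj_apply, ContinuousLinearMap.coe_fst', ContinuousLinearMap.coe_snd',
    smul_eq_mul, Function.comp_apply, Pi.add_apply, Pi.sub_apply]
  congr 1
  refine Finset.sum_congr rfl fun x _ => ?_
  ring


/-- Fix `N ≥ 3` and a twice differentiable function `V : ℝ → ℝ`. For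
smooth functions `f` of `(q,p) ∈ ℝ^{ℤ/Nℤ} × ℝ^{ℤ/Nℤ}`, define the Liouville operator of the
unpinned chain by
`(𝒜 f)(q,p) = Σ_x [ p_x ∂f/∂q_x + (V'(q_{x+1} − q_x) − V'(q_x − q_{x−1})) ∂f/∂p_x ]`
(partial derivatives expressed through the Fréchet derivative in the direction of the
corresponding coordinate vector). Let `𝔍(q,p) = −(1/2) Σ_x V'(q_{x+1} − q_x)(p_x + p_{x+1})`.
Then, writing `r_x = q_{x+1} − q_x`, one has
`(𝒜 𝔍)(q,p) = −(1/2) Σ_x p_x² (V''(r_{x−1}) − V''(r_x))` for all `(q,p)`. -/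
theorem stmt18 (N : ℕ) [NeZero N] (hN : 3 ≤ N)
    (V : ℝ → ℝ) (hV : Differentiable ℝ V) (hV' : Differentiable ℝ (deriv V))
    (A : (((ZMod N → ℝ) × (ZMod N → ℝ)) → ℝ) → (((ZMod N → ℝ) × (ZMod N → ℝ)) → ℝ))
    (hA : ∀ f qp, A f qp = ∑ x : ZMod N,
        (qp.2 x * fderiv ℝ f qp (Pi.single x 1, 0)
          + (deriv V (qp.1 (x + 1) - qp.1 x) - deriv V (qp.1 x - qp.1 (x - 1)))
            * fderiv ℝ f qp (0, Pi.single x 1)))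
    (J : ((ZMod N → ℝ) × (ZMod N → ℝ)) → ℝ)
    (hJ : ∀ qp : (ZMod N → ℝ) × (ZMod N → ℝ), J qp =
      -(1 / 2) * ∑ x : ZMod N,
        deriv V (qp.1 (x + 1) - qp.1 x) * (qp.2 x + qp.2 (x + 1))) :
    ∀ qp : (ZMod N → ℝ) × (ZMod N → ℝ),
      A J qp = -(1 / 2) * ∑ x : ZMod N, (qp.2 x) ^ 2 *
        (deriv (deriv V) (qp.1 x - qp.1 (x - 1)) - deriv (deriv V) (qp.1 (x + 1) - qp.1 x)) := by
  intro qp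
  rw [hA, ContinuousLinearMap.sum_single_prod (fderiv ℝ J qp) qp.2 fun x =>
    deriv V (qp.1 (x + 1) - qp.1 x) - deriv V (qp.1 x - qp.1 (x - 1)),
    funext hJ, fderiv_energyCurrent_apply hV']
  congr 1
  have hshift : ∀ f : ZMod N → ℝ, ∑ x, f (x + 1) = ∑ x, f x :=
    fun f => Equiv.sum_comp (Equiv.addRight 1) f
  have hkin := hshift fun x => qp.2 x ^ 2 * deriv (deriv V) (qp.1 x - qp.1 (x - 1))
  have hpot := hshift fun x =>
    deriv V (qp.1 x - qp.1 (x - 1)) * deriv V (qp.1 (x + 1) - qp.1 x)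
  simp only [add_sub_cancel_right] at hkin hpot ⊢
  simp only [mul_sub (_ ^ 2), Finset.sum_sub_distrib]
  rw [← hkin, ← add_zero (_ - _), ← sub_eq_zero.mpr hpot]
  simp only [← Finset.sum_sub_distrib, ← Finset.sum_add_distrib]
  refine Finset.sum_congr rfl fun x _ => ?_
  ring
end

section
/- Fix an integer N ≥ 3, reals T > 0, λ > 0, γ > 0, and a measurable even twice differentiable function V : ℝ → ℝ with ∫_ℝ e^{−V(r)/T} dr < ∞ and ∫_ℝ V''(r)² e^{−V(r)/T} dr < ∞. Let μ be the product probability measure on ℝ^{ℤ/Nℤ} × ℝ^{ℤ/Nℤ} (coordinates (r_x, p_x)) under which the p_x are i.i.d. centered Gaussians of variance T and the r_x are i.i.d. with density Z⁻¹ e^{−V(r)/T}, all independent. Let G : ℤ/Nℤ → ℝ be the unique solution of λG(x) − γ(ΔG)(x) = δ_0(x), where (ΔG)(x) = G(x+1) + G(x−1) − 2G(x). Set W_x = V''(r_{x−1}) − V''(r_x), σ² = ∫ V''(r_0)² dμ − (∫ V''(r_0) dμ)². Then ∫ ( Σ_{x} p_x² W_x ) · ( Σ_{y,z} G(y−z)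 p_z² W_y ) dμ = −2 T² N σ² (ΔG)(0), where all sums run over ℤ/Nℤ. -/
open MeasureTheory ProbabilityTheory
open scoped NNReal

/-- The fourth moment of a centered Gaussian. -/
lemma integral_pow_four_gaussianReal (v : ℝ≥0) :
    ∫ x, x ^ 4 ∂(gaussianReal 0 v) = 3 * (v : ℝ) ^ 2 := by
  have key := iteratedDeriv_mgf_zero (X := fun x : ℝ => x) (μ := gaussianReal 0 v) (n := 4)
    (by simp)
  have hm : mgf (fun x : ℝ => x) (gaussianReal 0 v) = fun t => Real.exp (v * t ^ 2 / 2) := by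
    have := mgf_fun_id_gaussianReal (μ := 0) (v := v)
    simpa using this
  have hexp (t : ℝ) : HasDerivAt (fun t : ℝ => Real.exp (v * t ^ 2 / 2))
      (Real.exp (v * t ^ 2 / 2) * (v * t)) t := by
    have h : HasDerivAt (fun t : ℝ => (v : ℝ) * t ^ 2 / 2) (v * t) t := by
      refine (((hasDerivAt_pow 2 t).const_mul (v : ℝ)).div_const 2).congr_deriv ?_
      norm_num
      ring
    exact h.exp
  have step (a b : ℝ → ℝ) (h : ∀ t, HasDerivAt a (b t - a t * (v * t)) t) :
      deriv (fun t => a t * Real.exp (v * t ^ 2 / 2)) =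
        fun t => b t * Real.exp (v * t ^ 2 / 2) := by
    funext t
    refine ((h t).mul (hexp t)).deriv.trans ?_
    ring
  have hpow (n : ℕ) (c t : ℝ) : HasDerivAt (fun t : ℝ => c * t ^ n) (c * (n * t ^ (n - 1))) t :=
    (hasDerivAt_pow n t).const_mul c
  have d1 := step (fun _ => 1) (fun t => v * t) fun t =>
    (hasDerivAt_const t (1 : ℝ)).congr_deriv (by ring)
  have d2 := step (fun t => v * t) (fun t => v + v ^ 2 * t ^ 2) fun t =>
    ((hasDerivAt_id t).const_mul (v : ℝ)).congr_deriv (by ring)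
  have d3 := step (fun t => v + v ^ 2 * t ^ 2) (fun t => 3 * v ^ 2 * t + v ^ 3 * t ^ 3) fun t =>
    ((hpow 2 (v ^ 2) t).const_add (v : ℝ)).congr_deriv (by norm_num; ring)
  have d4 := step (fun t => 3 * v ^ 2 * t + v ^ 3 * t ^ 3)
      (fun t => 3 * v ^ 2 + 6 * v ^ 3 * t ^ 2 + v ^ 4 * t ^ 4) fun t =>
    (((hasDerivAt_id t).const_mul (3 * (v : ℝ) ^ 2)).add (hpow 3 (v ^ 3) t)).congr_deriv
      (by norm_num; ring)
  simp only [one_mul] at d1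
  rw [hm] at key
  simp only [iteratedDeriv_succ, iteratedDeriv_zero, d1, d2, d3, d4] at key
  simpa using key.symm

/-- Covariance structure of i.i.d. coordinates. -/
lemma integral_pi_mul_eval {ι : Type*} [Fintype ι] [DecidableEq ι] (ν : Measure ℝ)
    [IsProbabilityMeasure ν] (h : ℝ → ℝ) (hm : Measurable h) (x y : ι) :
    ∫ ω, h (ω x) * h (ω y) ∂(Measure.pi fun _ : ι => ν) =
      (∫ r, h r ∂ν) ^ 2
        + if x = y then (∫ r, h r ^ 2 ∂ν) - (∫ r, h r ∂ν) ^ 2 else 0 := by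
  have hc (g : ℝ → ℝ) (hg : Measurable g) (i : ι) :
      ∫ ω, g (ω i) ∂(Measure.pi fun _ : ι => ν) = ∫ r, g r ∂ν :=
    integral_comp_eval (μ := fun _ : ι => ν) hg.aestronglyMeasurable
  split_ifs with hxy
  · subst hxy
    rw [← hc _ (hm.pow_const 2) x]
    simp [pow_two]
  · have hi : IndepFun (fun ω : ι → ℝ => h (ω x)) (fun ω => h (ω y))
        (Measure.pi fun _ : ι => ν) :=
      (iIndepFun_pi (μ := fun _ : ι => ν) (X := fun _ => h)
        fun _ => hm.aemeasurable).indepFun hxy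
    rw [hi.integral_fun_mul_eq_mul_integral (hm.comp (measurable_pi_apply x)).aestronglyMeasurable
      (hm.comp (measurable_pi_apply y)).aestronglyMeasurable, hc h hm, hc h hm]
    ring

/-- A square-integrable function of one coordinate is square-integrable for the product measure. -/
lemma memLp_pi_eval {ι : Type*} [Fintype ι] (ν : Measure ℝ)
    [IsProbabilityMeasure ν] (h : ℝ → ℝ) (hh : MemLp h 2 ν) (x : ι) :
    MemLp (fun ω : ι → ℝ => h (ω x)) 2 (Measure.pi fun _ : ι => ν) :=
  hh.comp_measurePreserving (measurePreserving_eval (fun _ : ι => ν) x)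

/-- Contraction of the kernel `G` against the covariances of the gradient field and of the kinetic
energies. -/
lemma sum_green_mul_covariance {N : ℕ} [NeZero N] (G : ZMod N → ℝ) (T s : ℝ) :
    ∑ x : ZMod N, ∑ y : ZMod N, ∑ z : ZMod N,
      G (y - z) * (((if x - 1 = y - 1 then s else 0) - (if x - 1 = y then s else 0)
        - (if x = y - 1 then s else 0) + (if x = y then s else 0)) *
        (T ^ 2 + if x = z then 2 * T ^ 2 else 0))
      = -2 * T ^ 2 * (N : ℝ) * s * (G 1 + G (-1) - 2 * G 0) := by
  have e (x y : ZMod N) : x = y - 1 ↔ x + 1 = y := eq_sub_iff_add_eq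
  have hS (y : ZMod N) : ∑ z, G (y - z) = ∑ z, G z :=
    Equiv.sum_comp (Equiv.subLeft y) G
  have hz (x y : ZMod N) (c : ℝ) :
      ∑ z, G (y - z) * (c * (T ^ 2 + if x = z then 2 * T ^ 2 else 0)) =
        c * (T ^ 2 * ∑ z, G z + 2 * T ^ 2 * G (y - x)) := by
    simp only [mul_add, mul_ite, mul_zero, Finset.sum_add_distrib, Finset.sum_ite_eq,
      Finset.mem_univ, if_true, ← Finset.sum_mul, hS]
    ring
  simp only [hz, sub_left_inj]
  simp only [e, add_mul, sub_mul, Finset.sum_add_distrib,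
    Finset.sum_sub_distrib, ite_mul, zero_mul, Finset.sum_ite_eq, Finset.mem_univ, if_true,
    sub_self, sub_sub_cancel_left, add_sub_cancel_left, Finset.sum_const, Finset.card_univ,
    ZMod.card, nsmul_eq_mul]
  ring

lemma isProbabilityMeasure_withDensity_exp (V : ℝ → ℝ) (T : ℝ)
    (hZfin : Integrable (fun r : ℝ => Real.exp (-V r / T))) :
    IsProbabilityMeasure (volume.withDensity fun r : ℝ =>
      ENNReal.ofReal ((∫ r : ℝ, Real.exp (-V r / T))⁻¹ * Real.exp (-V r / T))) := by
  have hpos : 0 < ∫ r : ℝ, Real.exp (-V r / T) := integral_exp_pos hZfin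
  refine ⟨?_⟩
  rw [withDensity_apply _ MeasurableSet.univ, Measure.restrict_univ,
    ← ofReal_integral_eq_lintegral_ofReal (hZfin.const_mul _)
      (Filter.Eventually.of_forall fun r => by positivity),
    integral_const_mul, inv_mul_cancel₀ hpos.ne', ENNReal.ofReal_one]

lemma memLp_two_withDensity_exp (V f : ℝ → ℝ) (T c : ℝ) (hV : Measurable V) (hf : Measurable f)
    (hc : 0 ≤ c) (hV2fin : Integrable (fun r : ℝ => f r ^ 2 * Real.exp (-V r / T))) :
    MemLp f 2 (volume.withDensity fun r : ℝ =>
      ENNReal.ofReal (c * Real.exp (-V r / T))) := by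
  rw [memLp_two_iff_integrable_sq hf.aestronglyMeasurable,
    integrable_withDensity_iff (by fun_prop) (by simp)]
  refine (hV2fin.const_mul c).congr (Filter.Eventually.of_forall fun r => ?_)
  simp only
  rw [ENNReal.toReal_ofReal (by positivity)]
  ring

/-- The quadratic form of `G` for a general single-site law `ρ` and square-integrable `f`. -/
lemma integral_green_quadratic {N : ℕ} [NeZero N] (G : ZMod N → ℝ) (v : ℝ≥0) (ρ : Measure ℝ)
    [IsProbabilityMeasure ρ] (f : ℝ → ℝ) (hf : Measurable f) (hf2 : MemLp f 2 ρ) :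
    ∫ rp : (ZMod N → ℝ) × (ZMod N → ℝ),
        (∑ x, rp.2 x ^ 2 * (f (rp.1 (x - 1)) - f (rp.1 x))) *
        (∑ y, ∑ z, G (y - z) * rp.2 z ^ 2 * (f (rp.1 (y - 1)) - f (rp.1 y)))
        ∂((Measure.pi fun _ => ρ).prod (Measure.pi fun _ => gaussianReal 0 v))
      = -2 * (v : ℝ) ^ 2 * (N : ℝ) * ((∫ r, f r ^ 2 ∂ρ) - (∫ r, f r ∂ρ) ^ 2) *
        (G 1 + G (-1) - 2 * G 0) := by
  set P : Measure (ZMod N → ℝ) := Measure.pi fun _ => ρ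
  set Q : Measure (ZMod N → ℝ) := Measure.pi fun _ => gaussianReal 0 v
  set s : ℝ := (∫ r, f r ^ 2 ∂ρ) - (∫ r, f r ∂ρ) ^ 2 with hs
  have hfL (x : ZMod N) : MemLp (fun ω : ZMod N → ℝ => f (ω x)) 2 P := memLp_pi_eval ρ f hf2 x
  have hff (x y : ZMod N) : Integrable (fun ω : ZMod N → ℝ => f (ω x) * f (ω y)) P :=
    (hfL x).integrable_mul (hfL y)
  have hW (x : ZMod N) : MemLp (fun ω : ZMod N → ℝ => f (ω (x - 1)) - f (ω x)) 2 P :=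
    (hfL (x - 1)).sub (hfL x)
  have hq : MemLp (fun p : ℝ => p ^ 2) 2 (gaussianReal 0 v) := by
    rw [memLp_two_iff_integrable_sq (by fun_prop)]
    have := (memLp_id_gaussianReal' (μ := 0) (v := v) 4 (by simp)).integrable_norm_pow
      (p := 4) (by simp)
    refine this.congr (Filter.Eventually.of_forall fun p => ?_)
    simp only [id, Real.norm_eq_abs]
    rw [← pow_mul, Even.pow_abs (by decide)]
  have hqL (x : ZMod N) : MemLp (fun ω : ZMod N → ℝ => ω x ^ 2) 2 Q :=
    memLp_pi_eval (gaussianReal 0 v) _ hq x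
  have hWW (x y : ZMod N) :
      ∫ ω, (f (ω (x - 1)) - f (ω x)) * (f (ω (y - 1)) - f (ω y)) ∂P =
        (if x - 1 = y - 1 then s else 0) - (if x - 1 = y then s else 0)
        - (if x = y - 1 then s else 0) + (if x = y then s else 0) := by
    have h (ω : ZMod N → ℝ) : (f (ω (x - 1)) - f (ω x)) * (f (ω (y - 1)) - f (ω y)) =
        f (ω (x - 1)) * f (ω (y - 1)) - f (ω (x - 1)) * f (ω y) - f (ω x) * f (ω (y - 1))
          + f (ω x) * f (ω y) := by ring
    simp only [h]
    have h2 : Integrable (fun ω : ZMod N → ℝ =>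
        f (ω (x - 1)) * f (ω (y - 1)) - f (ω (x - 1)) * f (ω y)) P := (hff _ _).sub (hff _ _)
    have h3 : Integrable (fun ω : ZMod N → ℝ =>
        f (ω (x - 1)) * f (ω (y - 1)) - f (ω (x - 1)) * f (ω y) - f (ω x) * f (ω (y - 1))) P :=
      h2.sub (hff _ _)
    rw [integral_add h3 (hff _ _), integral_sub h2 (hff _ _), integral_sub (hff _ _) (hff _ _)]
    simp only [P, integral_pi_mul_eval ρ f hf, ← hs]
    ring
  have hsq : ∫ p, p ^ 2 ∂(gaussianReal 0 v) = v := by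
    have := variance_fun_id_gaussianReal (μ := 0) (v := v)
    rwa [variance_of_integral_eq_zero (by fun_prop) (by simp)] at this
  have hpp (x z : ZMod N) : ∫ ω, ω x ^ 2 * ω z ^ 2 ∂Q =
      (v : ℝ) ^ 2 + if x = z then 2 * (v : ℝ) ^ 2 else 0 := by
    rw [integral_pi_mul_eval (gaussianReal 0 v) (fun p => p ^ 2) (by fun_prop), hsq]
    simp only [← pow_mul, Nat.reduceMul, integral_pow_four_gaussianReal]
    congr 2
    ring
  rw [← sum_green_mul_covariance G v s]
  have hexp (rp : (ZMod N → ℝ) × (ZMod N → ℝ)) :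
      (∑ x, rp.2 x ^ 2 * (f (rp.1 (x - 1)) - f (rp.1 x))) *
        (∑ y, ∑ z, G (y - z) * rp.2 z ^ 2 * (f (rp.1 (y - 1)) - f (rp.1 y))) =
      ∑ x, ∑ y, ∑ z, G (y - z) *
        (((f (rp.1 (x - 1)) - f (rp.1 x)) * (f (rp.1 (y - 1)) - f (rp.1 y))) *
          (rp.2 x ^ 2 * rp.2 z ^ 2)) := by
    rw [Finset.sum_mul]
    refine Finset.sum_congr rfl fun x _ => ?_
    rw [Finset.mul_sum]
    refine Finset.sum_congr rfl fun y _ => ?_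
    rw [Finset.mul_sum]
    refine Finset.sum_congr rfl fun z _ => ?_
    ring
  have hint (x y z : ZMod N) : Integrable (fun rp : (ZMod N → ℝ) × (ZMod N → ℝ) => G (y - z) *
        (((f (rp.1 (x - 1)) - f (rp.1 x)) * (f (rp.1 (y - 1)) - f (rp.1 y))) *
          (rp.2 x ^ 2 * rp.2 z ^ 2))) (P.prod Q) :=
    (((hW x).integrable_mul (hW y)).mul_prod ((hqL x).integrable_mul (hqL z))).const_mul _
  simp only [hexp]
  rw [integral_finsetSum _ fun x _ => integrable_finsetSum _ fun y _ =>
    integrable_finsetSum _ fun z _ => hint x y z]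
  refine Finset.sum_congr rfl fun x _ => ?_
  rw [integral_finsetSum _ fun y _ => integrable_finsetSum _ fun z _ => hint x y z]
  refine Finset.sum_congr rfl fun y _ => ?_
  rw [integral_finsetSum _ fun z _ => hint x y z]
  refine Finset.sum_congr rfl fun z _ => ?_
  rw [integral_const_mul, integral_prod_mul
    (fun ω : ZMod N → ℝ => (f (ω (x - 1)) - f (ω x)) * (f (ω (y - 1)) - f (ω y)))
    (fun ω : ZMod N → ℝ => ω x ^ 2 * ω z ^ 2), hWW, hpp]

/-- Fix `N ≥ 3`, reals `T > 0`, `λ > 0`, `γ > 0`, and a measurable even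
twice differentiable `V : ℝ → ℝ` with `∫ e^{−V/T} < ∞` and `∫ V''² e^{−V/T} < ∞`. Let `μ`
be the product probability measure on `ℝ^{ℤ/Nℤ} × ℝ^{ℤ/Nℤ}` (coordinates `(r_x, p_x)`)
under which the `p_x` are i.i.d. centered Gaussians of variance `T` and the `r_x` are i.i.d.
with density `Z⁻¹ e^{−V(r)/T}`, all independent. Let `G : ℤ/Nℤ → ℝ` be the unique solution
of `λG(x) − γ(ΔG)(x) = δ_0(x)`. Set `W_x = V''(r_{x−1}) − V''(r_x)` and
`σ² = ∫ V''(r_0)² dμ − (∫ V''(r_0) dμ)²`. Then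
`∫ (Σ_x p_x² W_x)·(Σ_{y,z} G(y−z) p_z² W_y) dμ = −2 T² N σ² (ΔG)(0)`. -/
theorem stmt19 (N : ℕ) [NeZero N] (hN : 3 ≤ N)
    (T lam gam : ℝ) (hT : 0 < T) (hlam : 0 < lam) (hgam : 0 < gam)
    (V : ℝ → ℝ) (hVm : Measurable V)
    (hVd : Differentiable ℝ V) (hVd2 : Differentiable ℝ (deriv V))
    (hVeven : ∀ r : ℝ, V (-r) = V r)
    (hZfin : Integrable (fun r : ℝ => Real.exp (-V r / T)))
    (hV2fin : Integrable (fun r : ℝ => (deriv (deriv V) r) ^ 2 * Real.exp (-V r / T)))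
    (Z : ℝ) (hZ : Z = ∫ r : ℝ, Real.exp (-V r / T))
    (ρ : Measure ℝ)
    (hρ : ρ = volume.withDensity (fun r : ℝ => ENNReal.ofReal (Z⁻¹ * Real.exp (-V r / T))))
    (μ : Measure ((ZMod N → ℝ) × (ZMod N → ℝ)))
    (hμ : μ = (Measure.pi fun _ : ZMod N => ρ).prod
      (Measure.pi fun _ : ZMod N => gaussianReal 0 ⟨T, hT.le⟩))
    (G : ZMod N → ℝ)
    (hG : ∀ x : ZMod N,
      lam * G x - gam * (G (x + 1) + G (x - 1) - 2 * G x) = if x = 0 then 1 else 0)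
    (W : ((ZMod N → ℝ) × (ZMod N → ℝ)) → ZMod N → ℝ)
    (hW : ∀ rp x, W rp x = deriv (deriv V) (rp.1 (x - 1)) - deriv (deriv V) (rp.1 x))
    (σ2 : ℝ)
    (hσ2 : σ2 = (∫ rp, (deriv (deriv V) (rp.1 0)) ^ 2 ∂μ)
      - (∫ rp, deriv (deriv V) (rp.1 0) ∂μ) ^ 2) :
    ∫ rp, (∑ x : ZMod N, (rp.2 x) ^ 2 * W rp x) *
        (∑ y : ZMod N, ∑ z : ZMod N, G (y - z) * (rp.2 z) ^ 2 * W rp y) ∂μ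
      = -2 * T ^ 2 * (N : ℝ) * σ2 * (G 1 + G (-1) - 2 * G 0) := by
  have hf : Measurable (deriv (deriv V)) := measurable_deriv _
  have hprob : IsProbabilityMeasure ρ := by
    rw [hρ, hZ]
    exact isProbabilityMeasure_withDensity_exp V T hZfin
  have hf2 : MemLp (deriv (deriv V)) 2 ρ := by
    rw [hρ]
    refine memLp_two_withDensity_exp V _ T Z⁻¹ hVm hf ?_ hV2fin
    rw [hZ]
    positivity
  obtain ⟨v, rfl⟩ : ∃ v : ℝ≥0, (v : ℝ) = T := ⟨⟨T, hT.le⟩, rfl⟩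
  replace hμ : μ = (Measure.pi fun _ : ZMod N => ρ).prod
    (Measure.pi fun _ : ZMod N => gaussianReal 0 v) := hμ
  have hmarg (g : ℝ → ℝ) (hg : Measurable g) : ∫ rp, g (rp.1 0) ∂μ = ∫ r, g r ∂ρ := by
    rw [hμ, integral_fun_fst (fun ω : ZMod N → ℝ => g (ω 0)),
      integral_comp_eval (μ := fun _ : ZMod N => ρ) hg.aestronglyMeasurable]
    simp
  rw [hσ2, hmarg _ (hf.pow_const 2), hmarg _ hf, hμ]
  simp only [hW]
  exact integral_green_quadratic G v ρ _ hf hf2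
end
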